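/- arXiv:math/0602619 — 12 statements merged into one kernel-verified Lean document; each statement's English description precedes it below -/
import Mathlib

section
/- Let V be a finite-dimensional complex vector space, regarded also as a real vector space, and let J : V → V denote multiplication by i. Let R be a formal curvature tensor on V such that each endomorphism R(x,y) is ℂ-linear (commutes with J). Then for all x, y ∈ V: tr_ℝ(R(x,y) ∘ J) = Ric(y, Jx) − Ric(x, Jy), where tr_ℝ denotes the trace as an ℝ-linear endomorphism. -/
/-- The Ricci tensor of an `ℝ`-bilinear map `R : V × V → End ℝ V`:
`Ric(x,y) := tr (z ↦ R(z,x) y)`. -/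
noncomputable def formalRicci {V : Type*} [AddCommGroup V] [Module ℝ V]
    (R : V →ₗ[ℝ] V →ₗ[ℝ] Module.End ℝ V) (x y : V) : ℝ :=
  LinearMap.trace ℝ V
    { toFun := fun z => R z x y
      map_add' := by intros; simp
      map_smul' := by intros; simp }

/-- Multiplication by `i` on a complex vector space, as a real-linear endomorphism. -/
noncomputable def Jmul (V : Type*) [AddCommGroup V] [Module ℂ V] : Module.End ℝ V :=
  (Complex.I • (LinearMap.id : V →ₗ[ℂ] V)).restrictScalars ℝ

theorem formalRicci_eq_trace {V : Type*} [AddCommGroup V] [Module ℝ V]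
    (R : V →ₗ[ℝ] V →ₗ[ℝ] Module.End ℝ V) (x y : V) :
    formalRicci R x y = LinearMap.trace ℝ V ((R.flip x).flip y) :=
  rfl

/-- If the values of `R` commute with `J`, then `Ric(x, Jy) = tr (z ↦ R(Jz, x) y)`. -/
theorem formalRicci_Jmul_right {V : Type*} [AddCommGroup V] [Module ℂ V]
    (R : V →ₗ[ℝ] V →ₗ[ℝ] Module.End ℝ V)
    (hJ : ∀ x y : V, (R x y) ∘ₗ Jmul V = Jmul V ∘ₗ (R x y)) (x y : V) :
    formalRicci R x (Jmul V y) = LinearMap.trace ℝ V ((R.flip x).flip y * Jmul V) := by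
  rw [LinearMap.trace_mul_comm, formalRicci_eq_trace]
  congr 1
  ext z
  exact LinearMap.congr_fun (hJ z x) y

/-- For a formal curvature tensor `R` on a finite-dimensional complex vector space `V`
(regarded as real), whose values commute with `J` (multiplication by `i`),
`tr_ℝ (R(x,y) ∘ J) = Ric(y, Jx) − Ric(x, Jy)`. -/
theorem trace_curvature_comp_J {V : Type*} [AddCommGroup V] [Module ℂ V]
    [FiniteDimensional ℂ V]
    (R : V →ₗ[ℝ] V →ₗ[ℝ] Module.End ℝ V)
    (halt : ∀ x y : V, R x y = - R y x)
    (hbianchi : ∀ x y z : V, R x y z + R y z x + R z x y = 0)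
    (hJ : ∀ x y : V, (R x y) ∘ₗ Jmul V = Jmul V ∘ₗ (R x y)) :
    ∀ x y : V,
      LinearMap.trace ℝ V ((R x y) ∘ₗ Jmul V) =
        formalRicci R y (Jmul V x) - formalRicci R x (Jmul V y) := by
  intro x y
  rw [formalRicci_Jmul_right R hJ, formalRicci_Jmul_right R hJ, ← map_sub]
  congr 1
  ext z
  change R x y (Jmul V z) = R (Jmul V z) y x - R (Jmul V z) x y
  have hb := hbianchi x y (Jmul V z)
  rw [halt y, LinearMap.neg_apply] at hb
  rw [← sub_eq_zero, ← hb]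
  abel
end

section
/- Let V be a finite-dimensional complex vector space and R a formal curvature tensor on V (with respect to the underlying real structure) such that each R(x,y) is ℂ-linear. Then the complex trace tr_ℂ(R(x,y)) (the trace of R(x,y) as a ℂ-linear endomorphism) vanishes for all x, y ∈ V if and only if both bilinear forms (x,y) ↦ Ric(x,y) and (x,y) ↦ Ric(x, iy) are symmetric. -/
/-- The Ricci tensor (real trace) of an `ℝ`-bilinear map `R` on a complex vector space
with `ℂ`-linear values: `Ric(x,y) := tr_ℝ (z ↦ R(z,x) y)`. -/
noncomputable def cRicci {V : Type*} [AddCommGroup V] [Module ℂ V]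
    (R : V →ₗ[ℝ] V →ₗ[ℝ] (V →ₗ[ℂ] V)) (x y : V) : ℝ :=
  LinearMap.trace ℝ V
    { toFun := fun z => R z x y
      map_add' := by intros; simp
      map_smul' := by intros; simp }

/-- The real trace of a complex-linear endomorphism is twice the real part of its complex trace. -/
theorem LinearMap.trace_restrictScalars_complex {V : Type*} [AddCommGroup V] [Module ℂ V]
    [FiniteDimensional ℂ V] (f : V →ₗ[ℂ] V) :
    LinearMap.trace ℝ V (f.restrictScalars ℝ) = 2 * (LinearMap.trace ℂ V f).re := by
  classical
  let b := Module.finBasis ℂ V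
  rw [LinearMap.trace_eq_matrix_trace ℝ (Complex.basisOneI.smulTower b),
    LinearMap.trace_eq_matrix_trace ℂ b, Matrix.trace, Matrix.trace, Fintype.sum_prod_type_right,
    Complex.re_sum, Finset.mul_sum]
  refine Finset.sum_congr rfl fun i _ => ?_
  simp [LinearMap.toMatrix_apply, Module.Basis.smulTower_repr, Fin.sum_univ_two, two_mul]

/-- Under the Bianchi identity, the antisymmetric part of `(x, y) ↦ Ric(x, cy)` is governed by the
complex trace of `c R(x, y)`. -/
theorem cRicci_smul_sub_cRicci_smul {V : Type*} [AddCommGroup V] [Module ℂ V]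
    [FiniteDimensional ℂ V] (R : V →ₗ[ℝ] V →ₗ[ℝ] (V →ₗ[ℂ] V))
    (halt : ∀ x y : V, R x y = - R y x)
    (hbianchi : ∀ x y z : V, R x y z + R y z x + R z x y = 0) (c : ℂ) (x y : V) :
    cRicci R x (c • y) - cRicci R y (c • x) = -(2 * (c * LinearMap.trace ℂ V (R x y)).re) := by
  rw [← smul_eq_mul c, ← map_smul, ← LinearMap.trace_restrictScalars_complex, cRicci, cRicci,
    ← map_sub, ← map_neg]
  congr 1
  ext z
  have hb : R z x y - R z y x = -R x y z := by
    rw [halt z y, LinearMap.neg_apply, sub_neg_eq_add, eq_neg_iff_add_eq_zero, ← hbianchi x y z]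
    abel
  simp [← smul_sub, hb]

/-- For a formal curvature tensor `R` on a finite-dimensional complex vector space `V`
with `ℂ`-linear values, the complex trace `tr_ℂ (R(x,y))` vanishes for all `x, y`
iff both `(x,y) ↦ Ric(x,y)` and `(x,y) ↦ Ric(x, iy)` are symmetric bilinear forms. -/
theorem complexTrace_eq_zero_iff {V : Type*} [AddCommGroup V] [Module ℂ V]
    [FiniteDimensional ℂ V]
    (R : V →ₗ[ℝ] V →ₗ[ℝ] (V →ₗ[ℂ] V))
    (halt : ∀ x y : V, R x y = - R y x)
    (hbianchi : ∀ x y z : V, R x y z + R y z x + R z x y = 0) :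
    (∀ x y : V, LinearMap.trace ℂ V (R x y) = 0) ↔
      ((∀ x y : V, cRicci R x y = cRicci R y x) ∧
       (∀ x y : V, cRicci R x (Complex.I • y) = cRicci R y (Complex.I • x))) := by
  have ricci_sub (x y : V) : cRicci R x y - cRicci R y x =
      -(2 * (LinearMap.trace ℂ V (R x y)).re) := by
    simpa using cRicci_smul_sub_cRicci_smul R halt hbianchi 1 x y
  have ricci_I_sub (x y : V) : cRicci R x (Complex.I • y) - cRicci R y (Complex.I • x) =
      2 * (LinearMap.trace ℂ V (R x y)).im := by
    simpa using cRicci_smul_sub_cRicci_smul R halt hbianchi Complex.I x y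
  constructor
  · intro h
    refine ⟨fun x y => ?_, fun x y => ?_⟩
    · simpa [h, sub_eq_zero] using ricci_sub x y
    · simpa [h, sub_eq_zero] using ricci_I_sub x y
  · rintro ⟨hs, hI⟩ x y
    apply Complex.ext
    · simpa [hs x y] using ricci_sub x y
    · simpa [hI x y] using ricci_I_sub x y
end

section
/- Let V be a finite-dimensional complex vector space and a : V × V → End_ℂ(V) an ℝ-bilinear alternating map that is conjugate-bilinear in the sense that a(ix, y) = −i·a(x,y) for all x, y ∈ V. If ∂a = 0, then a = 0. -/
/-- An `ℝ`-bilinear alternating map `a : V × V → End_ℂ(V)` on a finite-dimensional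
complex vector space, which is conjugate-bilinear in the sense `a(ix,y) = −i·a(x,y)`,
and which satisfies the first Bianchi identity `∂a = 0`, must vanish. -/
theorem conjugate_bilinear_bianchi_eq_zero {V : Type*} [AddCommGroup V] [Module ℂ V]
    [FiniteDimensional ℂ V]
    (a : V →ₗ[ℝ] V →ₗ[ℝ] (V →ₗ[ℂ] V))
    (halt : ∀ x y : V, a x y = - a y x)
    (hconj : ∀ x y : V, a (Complex.I • x) y = - (Complex.I • a x y))
    (hbianchi : ∀ x y z : V, a x y z + a y z x + a z x y = 0) :
    a = 0 := by
  ext y z x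
  have hI := hbianchi (Complex.I • x) y z
  rw [halt z, hconj, hconj, halt x z] at hI
  simp only [map_smul, LinearMap.neg_apply, LinearMap.smul_apply, smul_neg, neg_neg] at hI
  have hsum : a x y z - a y z x + a z x y = 0 := by
    have hsmul : Complex.I • (a x y z - a y z x + a z x y) = 0 := by
      rw [smul_add, smul_sub, ← neg_eq_zero, ← hI]
      abel
    exact (smul_eq_zero.mp hsmul).resolve_left Complex.I_ne_zero
  have htwo : (2 : ℂ) • a y z x = 0 := by
    calc (2 : ℂ) • a y z x
        = (a x y z + a y z x + a z x y) - (a x y z - a y z x + a z x y) := by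
          rw [two_smul]
          abel
      _ = 0 := by rw [hbianchi, hsum, sub_zero]
  simpa using htwo
end

section
/- Let V be a finite-dimensional complex vector space, 𝔤 ⊆ End_ℂ(V) a complex linear subspace, and a : V × V → 𝔤 an ℝ-bilinear alternating map with ∂a = 0. Then a decomposes uniquely as a = a₁ + a₂, where a₁, a₂ : V × V → 𝔤 are ℝ-bilinear alternating maps with ∂a₁ = 0 and ∂a₂ = 0, a₁ is ℂ-bilinear (a₁(ix,y) = i·a₁(x,y) for all x,y), and a₂ satisfies a₂(ix, iy) = a₂(x,y) for all x, y. -/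
open Complex in
/-- A form satisfying the first Bianchi identity with values in `ℂ`-linear endomorphisms has no
component that is conjugate-linear in both arguments. -/
theorem antilinear_part_eq_zero_of_bianchi {V : Type*} [AddCommGroup V] [Module ℂ V]
    {𝔤 : Submodule ℂ (V →ₗ[ℂ] V)} (a : V →ₗ[ℝ] V →ₗ[ℝ] 𝔤)
    (hbianchi : ∀ x y z : V,
      (a x y : V →ₗ[ℂ] V) z + (a y z : V →ₗ[ℂ] V) x + (a z x : V →ₗ[ℂ] V) y = 0) (x y : V) :
    a (I • x) y + a x (I • y) - I • a x y + I • a (I • x) (I • y) = 0 := by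
  ext z
  have h₁ := hbianchi x y z
  have h₂ := hbianchi (I • x) y z
  have h₃ := hbianchi x (I • y) z
  have h₄ := hbianchi (I • x) (I • y) z
  have h₅ := hbianchi x y (I • z)
  have h₆ := hbianchi (I • x) y (I • z)
  have h₇ := hbianchi x (I • y) (I • z)
  have h₈ := hbianchi (I • x) (I • y) (I • z)
  simp only [map_smul, Submodule.coe_add, Submodule.coe_sub, Submodule.coe_smul, Submodule.coe_zero,
    LinearMap.add_apply, LinearMap.sub_apply, LinearMap.smul_apply, LinearMap.zero_apply] at *
  linear_combination (norm := skip) (1 / 2 : ℂ) • (-I • h₁ + h₂ + h₃ + I • h₄ - h₅ - I • h₆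
    - I • h₇ + h₈)
  match_scalars <;> ring_nf <;> simp [I_sq]

open Complex in
/-- If a form satisfies the first Bianchi identity, so does its composition with
multiplication by `I` in both arguments. -/
theorem bianchi_comp_I {V : Type*} [AddCommGroup V] [Module ℂ V]
    {𝔤 : Submodule ℂ (V →ₗ[ℂ] V)} (a : V →ₗ[ℝ] V →ₗ[ℝ] 𝔤)
    (hbianchi : ∀ x y z : V,
      (a x y : V →ₗ[ℂ] V) z + (a y z : V →ₗ[ℂ] V) x + (a z x : V →ₗ[ℂ] V) y = 0) (x y z : V) :
    (a (I • x) (I • y) : V →ₗ[ℂ] V) z + (a (I • y) (I • z) : V →ₗ[ℂ] V) x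
      + (a (I • z) (I • x) : V →ₗ[ℂ] V) y = 0 := by
  have n₁ := LinearMap.congr_fun
    (congrArg Subtype.val (antilinear_part_eq_zero_of_bianchi a hbianchi x y)) z
  have n₂ := LinearMap.congr_fun
    (congrArg Subtype.val (antilinear_part_eq_zero_of_bianchi a hbianchi y z)) x
  have n₃ := LinearMap.congr_fun
    (congrArg Subtype.val (antilinear_part_eq_zero_of_bianchi a hbianchi z x)) y
  have h₁ := hbianchi x y z
  have h₂ := hbianchi (I • x) y z
  have h₃ := hbianchi x (I • y) z
  have h₄ := hbianchi (I • x) (I • y) z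
  have h₅ := hbianchi x y (I • z)
  have h₆ := hbianchi (I • x) y (I • z)
  have h₇ := hbianchi x (I • y) (I • z)
  have h₈ := hbianchi (I • x) (I • y) (I • z)
  simp only [map_smul, Submodule.coe_add, Submodule.coe_sub, Submodule.coe_smul, Submodule.coe_zero,
    LinearMap.add_apply, LinearMap.sub_apply, LinearMap.smul_apply, LinearMap.zero_apply] at *
  linear_combination (norm := skip) h₁ - (1 / 4 : ℂ) • (h₁ - I • (h₂ + h₃ + h₅) - (h₄ + h₆ + h₇)
    + I • h₈) - (I / 2) • (n₁ + n₂ + n₃)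
  match_scalars <;> ring_nf <;> simp [I_sq]

/-- An `ℝ`-bilinear alternating map `a : V × V → 𝔤 ⊆ End_ℂ(V)` satisfying the first
Bianchi identity decomposes uniquely as `a = a₁ + a₂` where `a₁` is `ℂ`-bilinear,
`a₂` satisfies `a₂(ix,iy) = a₂(x,y)`, and both pieces are alternating and satisfy
the first Bianchi identity. -/
theorem curvature_decomposition {V : Type*} [AddCommGroup V] [Module ℂ V]
    [FiniteDimensional ℂ V] (𝔤 : Submodule ℂ (V →ₗ[ℂ] V))
    (a : V →ₗ[ℝ] V →ₗ[ℝ] 𝔤)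
    (halt : ∀ x y : V, a x y = - a y x)
    (hbianchi : ∀ x y z : V,
      (a x y : V →ₗ[ℂ] V) z + (a y z : V →ₗ[ℂ] V) x + (a z x : V →ₗ[ℂ] V) y = 0) :
    ∃ a₁ a₂ : V →ₗ[ℝ] V →ₗ[ℝ] 𝔤,
      (a = a₁ + a₂ ∧
       (∀ x y : V, a₁ x y = - a₁ y x) ∧
       (∀ x y : V, a₂ x y = - a₂ y x) ∧
       (∀ x y z : V,
         (a₁ x y : V →ₗ[ℂ] V) z + (a₁ y z : V →ₗ[ℂ] V) x + (a₁ z x : V →ₗ[ℂ] V) y = 0) ∧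
       (∀ x y z : V,
         (a₂ x y : V →ₗ[ℂ] V) z + (a₂ y z : V →ₗ[ℂ] V) x + (a₂ z x : V →ₗ[ℂ] V) y = 0) ∧
       (∀ x y : V, a₁ (Complex.I • x) y = Complex.I • a₁ x y) ∧
       (∀ x y : V, a₂ (Complex.I • x) (Complex.I • y) = a₂ x y)) ∧
      (∀ b₁ b₂ : V →ₗ[ℝ] V →ₗ[ℝ] 𝔤,
        (a = b₁ + b₂ ∧
         (∀ x y : V, b₁ x y = - b₁ y x) ∧
         (∀ x y : V, b₂ x y = - b₂ y x) ∧
         (∀ x y z : V,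
           (b₁ x y : V →ₗ[ℂ] V) z + (b₁ y z : V →ₗ[ℂ] V) x + (b₁ z x : V →ₗ[ℂ] V) y = 0) ∧
         (∀ x y z : V,
           (b₂ x y : V →ₗ[ℂ] V) z + (b₂ y z : V →ₗ[ℂ] V) x + (b₂ z x : V →ₗ[ℂ] V) y = 0) ∧
         (∀ x y : V, b₁ (Complex.I • x) y = Complex.I • b₁ x y) ∧
         (∀ x y : V, b₂ (Complex.I • x) (Complex.I • y) = b₂ x y)) →
        b₁ = a₁ ∧ b₂ = a₂) := by
  have hI (v : V) : Complex.I • Complex.I • v = -v := by simp [smul_smul]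
  let J : V →ₗ[ℝ] V := (Complex.I • LinearMap.id : V →ₗ[ℂ] V).restrictScalars ℝ
  let c : V →ₗ[ℝ] V →ₗ[ℝ] 𝔤 := a.compl₁₂ J J
  have hc (x y : V) : c x y = a (Complex.I • x) (Complex.I • y) := rfl
  have hcb := bianchi_comp_I a hbianchi
  have hlin := antilinear_part_eq_zero_of_bianchi a hbianchi
  refine ⟨(1 / 2 : ℝ) • (a + (-1 : ℝ) • c), (1 / 2 : ℝ) • (a + c),
    ⟨?_, fun x y => ?_, fun x y => ?_, fun x y z => ?_, fun x y z => ?_, fun x y => ?_,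
      fun x y => ?_⟩, ?_⟩
  · module
  · simp only [LinearMap.smul_apply, LinearMap.add_apply, hc, halt x y,
      halt (Complex.I • x) (Complex.I • y)]
    module
  · simp only [LinearMap.smul_apply, LinearMap.add_apply, hc, halt x y,
      halt (Complex.I • x) (Complex.I • y)]
    module
  · simp only [LinearMap.smul_apply, LinearMap.add_apply, hc, Submodule.coe_add,
      Submodule.coe_smul_of_tower]
    linear_combination (norm := module) (1 / 2 : ℝ) • (hbianchi x y z - hcb x y z)
  · simp only [LinearMap.smul_apply, LinearMap.add_apply, hc, Submodule.coe_add,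
      Submodule.coe_smul_of_tower]
    linear_combination (norm := module) (1 / 2 : ℝ) • (hbianchi x y z + hcb x y z)
  · have hxy := hlin x y
    simp only [LinearMap.smul_apply, LinearMap.add_apply, hc, hI, map_neg, LinearMap.neg_apply]
    linear_combination (norm := module) (1 / 2 : ℝ) • hxy
  · simp only [LinearMap.smul_apply, LinearMap.add_apply, hc, hI, map_neg, LinearMap.neg_apply]
    module
  · rintro b₁ b₂ ⟨rfl, hb₁, -, -, -, hb₁I, hb₂I⟩
    have hb₁I' (x y : V) : b₁ (Complex.I • x) (Complex.I • y) = -b₁ x y := by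
      rw [hb₁I, hb₁, hb₁I, hb₁ y x, smul_neg, smul_neg, smul_neg, smul_smul,
        Complex.I_mul_I, neg_one_smul, neg_neg]
    constructor <;> ext1 x <;> ext1 y <;>
      simp only [LinearMap.smul_apply, LinearMap.add_apply, hc, hb₁I', hb₂I] <;> module
end

section
/- Let V be a finite-dimensional complex vector space and g : V × V → ℂ a nondegenerate symmetric ℂ-bilinear form. Let R : V × V → End_ℂ(V) be an ℝ-bilinear alternating map satisfying the first Bianchi identity R(x,y)z + R(y,z)x + R(z,x)y = 0 and taking values in 𝔰𝔬(V,g), i.e. g(R(x,y)z, w) + g(z, R(x,y)w) = 0 for all x,y,z,w ∈ V. Then R is ℂ-bilinear: R(ix, y) = i·R(x,y) for all x, y ∈ V. -/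
/-- A function of four arguments that is skew in the first pair, skew in the second pair and
satisfies the first Bianchi identity is symmetric under exchange of the two pairs. -/
theorem pair_symm_of_skew_of_bianchi {V : Type*} (f : V → V → V → V → ℂ)
    (hskew : ∀ x y z w, f x y z w = - f y x z w)
    (hskew' : ∀ x y z w, f x y z w = - f x y w z)
    (hbianchi : ∀ x y z w, f x y z w + f y z x w + f z x y w = 0) (x y z w : V) :
    f x y z w = f z w x y := by
  linear_combination (hbianchi x y z w + hbianchi y z w x - hbianchi z w x y - hbianchi w x y z
    - hskew' y z w x - hskew' z w y x - hskew w y z x + hskew' y w z x + hskew' w x z y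
    + hskew x z w y - hskew' z x w y + hskew' x y w z) / 2

/-- A formal curvature tensor on a finite-dimensional complex vector space `V` with
values in `𝔰𝔬(V,g)`, for a nondegenerate symmetric `ℂ`-bilinear form `g`, is
automatically `ℂ`-bilinear: `R(ix,y) = i·R(x,y)`. -/
theorem curvature_so_complex_bilinear {V : Type*} [AddCommGroup V] [Module ℂ V]
    [FiniteDimensional ℂ V]
    (g : V →ₗ[ℂ] V →ₗ[ℂ] ℂ)
    (hgsymm : ∀ x y : V, g x y = g y x)
    (hgnondeg : ∀ x : V, (∀ y : V, g x y = 0) → x = 0)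
    (R : V →ₗ[ℝ] V →ₗ[ℝ] (V →ₗ[ℂ] V))
    (halt : ∀ x y : V, R x y = - R y x)
    (hbianchi : ∀ x y z : V, R x y z + R y z x + R z x y = 0)
    (hso : ∀ x y z w : V, g (R x y z) w + g z (R x y w) = 0) :
    ∀ x y : V, R (Complex.I • x) y = Complex.I • R x y := by
  have hpair := pair_symm_of_skew_of_bianchi (fun x y z w => g (R x y z) w)
    (fun x y z w => by simp [halt x y])
    (fun x y z w => by
      rw [hgsymm (R x y w) z]
      exact eq_neg_of_add_eq_zero_left (hso x y z w))
    (fun x y z w => by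
      simpa using congrArg (fun v => g v w) (hbianchi x y z))
  intro x y
  ext z
  refine sub_eq_zero.mp (hgnondeg _ fun w => ?_)
  have h₁ := hpair (Complex.I • x) y z w
  have h₂ := hpair x y z w
  simp only [map_smul, LinearMap.smul_apply] at h₁ h₂
  simp [h₁, h₂]
end

section
/- Let V be a finite-dimensional complex vector space and h a nondegenerate Hermitian form on V (ℂ-linear in the first argument, conjugate-linear in the second, with h(w,z) equal to the complex conjugate of h(z,w)). Let R : V × V → End_ℂ(V) be an ℝ-bilinear alternating map satisfying the first Bianchi identity R(x,y)z + R(y,z)x + R(z,x)y = 0 and taking values in 𝔲(V,h), i.e. h(R(x,y)z, w) + h(z, R(x,y)w) = 0 for all x,y,z,w ∈ V. Then R(ix, iy) = R(x,y) for all x, y ∈ V; consequently its Ricci tensor Ric(x,y) := tr_ℝ(z ↦ R(z,x)y) satisfies Ric(ix, iy) = Ric(x,y). -/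
/-- A real 4-tensor with the algebraic symmetries of a Riemann curvature tensor is symmetric
under exchange of the first and the last pair of arguments. -/
theorem curvature_pair_symm {V : Type*} (T : V → V → V → V → ℝ)
    (h₁ : ∀ x y z w, T x y z w = -T y x z w)
    (h₂ : ∀ x y z w, T x y z w = -T x y w z)
    (h₃ : ∀ x y z w, T x y z w + T y z x w + T z x y w = 0) (x y z w : V) :
    T x y z w = T z w x y := by
  linarith [h₃ x y z w, h₃ y z w x, h₃ z w x y, h₃ w x y z,
    h₁ x y z w, h₂ x y z w, h₁ y z x w, h₂ y z x w, h₁ z x y w, h₂ z x y w,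
    h₁ y z w x, h₂ y z w x, h₁ z w y x, h₂ z w y x, h₁ w y z x, h₂ w y z x,
    h₁ z w x y, h₂ z w x y, h₁ w x z y, h₂ w x z y, h₁ x z w y, h₂ x z w y,
    h₁ w x y z, h₂ w x y z, h₁ x y w z, h₂ x y w z, h₁ y w x z, h₂ y w x z]

/-- A sesquilinear form that is nondegenerate on the left is determined, in its left argument,
by its real part. -/
theorem eq_of_forall_re_eq {V : Type*} [AddCommGroup V] [Module ℂ V]
    (h : V →ₗ[ℂ] V →ₛₗ[starRingEnd ℂ] ℂ)
    (hnondeg : ∀ z : V, (∀ w : V, h z w = 0) → z = 0) {a b : V}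
    (hab : ∀ w, (h a w).re = (h b w).re) : a = b := by
  refine sub_eq_zero.mp (hnondeg _ fun w => ?_)
  have h₁ := hab w
  have h₂ := hab (Complex.I • w)
  simp only [map_smulₛₗ, Complex.conj_I, smul_eq_mul, neg_mul, Complex.neg_re,
    Complex.I_mul_re, neg_neg] at h₂
  simpa [sub_eq_zero] using Complex.ext h₁ h₂

/-- If a curvature-like map satisfies `R(ix,iy) = R(x,y)`, then so does its Ricci tensor. -/
theorem cRicci_I_smul {V : Type*} [AddCommGroup V] [Module ℂ V] [FiniteDimensional ℂ V]
    (R : V →ₗ[ℝ] V →ₗ[ℝ] (V →ₗ[ℂ] V))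
    (hR : ∀ x y : V, R (Complex.I • x) (Complex.I • y) = R x y) (x y : V) :
    cRicci R (Complex.I • x) (Complex.I • y) = cRicci R x y := by
  let J : V →ₗ[ℝ] V := (LinearMap.lsmul ℂ V Complex.I).restrictScalars ℝ
  let A : V →ₗ[ℝ] V :=
    { toFun := fun z => R z x y
      map_add' := by intros; simp
      map_smul' := by intros; simp }
  have hJJ : J ∘ₗ J = -LinearMap.id := by
    ext z
    simp [J, smul_smul]
  have hswap (z : V) : R z (Complex.I • x) = -R (Complex.I • z) x := by
    rw [← hR z, smul_smul, Complex.I_mul_I, neg_one_smul, map_neg]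
  calc cRicci R (Complex.I • x) (Complex.I • y)
      = LinearMap.trace ℝ V (-(J ∘ₗ (A ∘ₗ J))) := by
        unfold cRicci
        congr 1
        ext z
        simp [J, A, hswap]
    _ = LinearMap.trace ℝ V A := by
        rw [map_neg, LinearMap.trace_comp_comm', LinearMap.comp_assoc, hJJ]
        simp
    _ = cRicci R x y := rfl

/-- A formal curvature tensor on a finite-dimensional complex vector space `V` with
values in `𝔲(V,h)`, for a nondegenerate Hermitian form `h`, satisfies
`R(ix,iy) = R(x,y)`; consequently its Ricci tensor satisfies `Ric(ix,iy) = Ric(x,y)`. -/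
theorem curvature_unitary_hermitian_type {V : Type*} [AddCommGroup V] [Module ℂ V]
    [FiniteDimensional ℂ V]
    (h : V →ₗ[ℂ] V →ₛₗ[starRingEnd ℂ] ℂ)
    (hherm : ∀ z w : V, h w z = starRingEnd ℂ (h z w))
    (hnondeg : ∀ z : V, (∀ w : V, h z w = 0) → z = 0)
    (R : V →ₗ[ℝ] V →ₗ[ℝ] (V →ₗ[ℂ] V))
    (halt : ∀ x y : V, R x y = - R y x)
    (hbianchi : ∀ x y z : V, R x y z + R y z x + R z x y = 0)
    (hu : ∀ x y z w : V, h (R x y z) w + h z (R x y w) = 0) :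
    (∀ x y : V, R (Complex.I • x) (Complex.I • y) = R x y) ∧
    (∀ x y : V, cRicci R (Complex.I • x) (Complex.I • y) = cRicci R x y) := by
  have hre (z w : V) : (h z w).re = (h w z).re := by
    rw [hherm z w, Complex.conj_re]
  have hpair := curvature_pair_symm (fun x y z w => (h (R x y z) w).re)
    (fun x y z w => by simp [halt x y])
    (fun x y z w => by
      have := congrArg Complex.re (hu x y z w)
      rw [Complex.add_re, Complex.zero_re, hre z] at this
      linarith)
    (fun x y z w => by
      simpa using congrArg (fun v => (h v w).re) (hbianchi x y z))
  have hR (x y : V) : R (Complex.I • x) (Complex.I • y) = R x y := by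
    ext z
    refine eq_of_forall_re_eq h hnondeg fun w => ?_
    rw [hpair, hpair x y]
    simp [← mul_assoc]
  exact ⟨hR, cRicci_I_smul R hR⟩
end

section
/- For every φ ∈ E* and every x ∈ E, the trace of the endomorphism y ↦ μ(φ)(x,y) of E equals (m+r)·φ(x). Consequently, the linear map φ ↦ μ(φ) from E* to the space of bilinear maps E × E → E is injective. -/
open scoped TensorProduct

/-- For `E = W ⊗ U` with `dim W = m ≥ 1`, `dim U = r ≥ 1`, and `μ : E* → Bil(E,E;E)`
the linear map determined by
`μ(φ)(u⊗v, u'⊗v') = φ(u⊗v')·(u'⊗v) + φ(u'⊗v)·(u⊗v')`, the trace of `y ↦ μ(φ)(x,y)`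
equals `(m+r)·φ(x)`; consequently `φ ↦ μ(φ)` is injective. -/
theorem trace_mu_and_injective {W U : Type*}
    [AddCommGroup W] [Module ℝ W] [FiniteDimensional ℝ W]
    [AddCommGroup U] [Module ℝ U] [FiniteDimensional ℝ U]
    (hm : 1 ≤ Module.finrank ℝ W) (hr : 1 ≤ Module.finrank ℝ U)
    (μ : (W ⊗[ℝ] U →ₗ[ℝ] ℝ) →ₗ[ℝ]
      (W ⊗[ℝ] U →ₗ[ℝ] W ⊗[ℝ] U →ₗ[ℝ] W ⊗[ℝ] U))
    (hμ : ∀ (φ : W ⊗[ℝ] U →ₗ[ℝ] ℝ) (u u' : W) (v v' : U),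
      μ φ (u ⊗ₜ[ℝ] v) (u' ⊗ₜ[ℝ] v') =
        φ (u ⊗ₜ[ℝ] v') • (u' ⊗ₜ[ℝ] v) + φ (u' ⊗ₜ[ℝ] v) • (u ⊗ₜ[ℝ] v')) :
    (∀ (φ : W ⊗[ℝ] U →ₗ[ℝ] ℝ) (x : W ⊗[ℝ] U),
      LinearMap.trace ℝ (W ⊗[ℝ] U) (μ φ x) =
        ((Module.finrank ℝ W + Module.finrank ℝ U : ℕ) : ℝ) * φ x) ∧
    Function.Injective μ := by
  have trace_eq : ∀ (φ : W ⊗[ℝ] U →ₗ[ℝ] ℝ) (x : W ⊗[ℝ] U),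
      LinearMap.trace ℝ (W ⊗[ℝ] U) (μ φ x) =
        ((Module.finrank ℝ W + Module.finrank ℝ U : ℕ) : ℝ) * φ x := by
    intro φ x
    induction x using TensorProduct.induction_on with
    | zero => simp
    | add x y hx hy => rw [map_add, map_add, hx, hy, map_add, mul_add]
    | tmul u v =>
      have key : μ φ (u ⊗ₜ[ℝ] v) =
          TensorProduct.map LinearMap.id
            ((φ ∘ₗ TensorProduct.mk ℝ W U u).smulRight v) +
          TensorProduct.map
            ((φ ∘ₗ (TensorProduct.mk ℝ W U).flip v).smulRight u) LinearMap.id := by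
        ext u' v'
        simp [hμ, TensorProduct.tmul_smul, TensorProduct.smul_tmul']
      rw [key, map_add, LinearMap.trace_tensorProduct', LinearMap.trace_tensorProduct',
        LinearMap.trace_id, LinearMap.trace_id, LinearMap.trace_smulRight,
        LinearMap.trace_smulRight]
      simp only [LinearMap.comp_apply, TensorProduct.mk_apply, LinearMap.flip_apply]
      push_cast
      ring
  refine ⟨trace_eq, fun φ ψ h => LinearMap.ext fun x => ?_⟩
  have hpos : ((Module.finrank ℝ W + Module.finrank ℝ U : ℕ) : ℝ) ≠ 0 :=
    Nat.cast_ne_zero.mpr (by omega)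
  exact mul_left_cancel₀ hpos (by rw [← trace_eq, ← trace_eq, h])
end

section
/- For a bilinear form B on E, define k_B : E × E → End(E) by k_B(x,y)z = μ(B(x,·))(y,z) − μ(B(y,·))(x,z), where B(x,·) ∈ E* denotes the partial evaluation of B. Then k_B is alternating and satisfies the first Bianchi identity k_B(x,y)z + k_B(y,z)x + k_B(z,x)y = 0, and its Ricci tensor Ric(k_B)(x,y) := tr(z ↦ k_B(z,x)y) is given on pure tensors by Ric(k_B)(C⊗D, C'⊗D') = B(C'⊗D, C⊗D') + B(C⊗D', C'⊗D) − (m+r)·B(C⊗D, C'⊗D'). -/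
open scoped TensorProduct

noncomputable section

variable {W U : Type*}
  [AddCommGroup W] [Module ℝ W] [FiniteDimensional ℝ W]
  [AddCommGroup U] [Module ℝ U] [FiniteDimensional ℝ U]

/-- `k_B(x,y)z := μ(B(x,·))(y,z) − μ(B(y,·))(x,z)`. -/
def kB (μ : (W ⊗[ℝ] U →ₗ[ℝ] ℝ) →ₗ[ℝ]
      (W ⊗[ℝ] U →ₗ[ℝ] W ⊗[ℝ] U →ₗ[ℝ] W ⊗[ℝ] U))
    (B : W ⊗[ℝ] U →ₗ[ℝ] W ⊗[ℝ] U →ₗ[ℝ] ℝ)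
    (x y : W ⊗[ℝ] U) : W ⊗[ℝ] U →ₗ[ℝ] W ⊗[ℝ] U :=
  μ (B x) y - μ (B y) x

/-- The Ricci tensor of `k_B`: `Ric(k_B)(x,y) := tr (z ↦ k_B(z,x) y)`. -/
def ricciKB (μ : (W ⊗[ℝ] U →ₗ[ℝ] ℝ) →ₗ[ℝ]
      (W ⊗[ℝ] U →ₗ[ℝ] W ⊗[ℝ] U →ₗ[ℝ] W ⊗[ℝ] U))
    (B : W ⊗[ℝ] U →ₗ[ℝ] W ⊗[ℝ] U →ₗ[ℝ] ℝ)
    (x y : W ⊗[ℝ] U) : ℝ :=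
  LinearMap.trace ℝ (W ⊗[ℝ] U)
    { toFun := fun z => kB μ B z x y
      map_add' := by intros; simp [kB, map_add]; abel
      map_smul' := by intros; simp [kB, map_smul, smul_sub] }

/-- A bilinear map `M` on `W ⊗ U` with
`M(u⊗v, u'⊗v') = φ(u⊗v')·(u'⊗v) + φ(u'⊗v)·(u⊗v')` is symmetric. -/
theorem apply_comm_of_tmul {W U : Type*} [AddCommGroup W] [Module ℝ W]
    [AddCommGroup U] [Module ℝ U] {φ : W ⊗[ℝ] U →ₗ[ℝ] ℝ}
    {M : W ⊗[ℝ] U →ₗ[ℝ] W ⊗[ℝ] U →ₗ[ℝ] W ⊗[ℝ] U}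
    (hM : ∀ (u u' : W) (v v' : U), M (u ⊗ₜ[ℝ] v) (u' ⊗ₜ[ℝ] v') =
      φ (u ⊗ₜ[ℝ] v') • (u' ⊗ₜ[ℝ] v) + φ (u' ⊗ₜ[ℝ] v) • (u ⊗ₜ[ℝ] v'))
    (x y : W ⊗[ℝ] U) : M x y = M y x := by
  have h : M = M.flip := by
    ext u v u' v'
    simp [hM, add_comm]
  exact LinearMap.congr_fun₂ h x y

/-- The trace of `z ↦ M(z, u'⊗v')` is `(dim W + dim U)·φ(u'⊗v')`. -/
theorem trace_flip_apply_tmul {W U : Type*}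
    [AddCommGroup W] [Module ℝ W] [FiniteDimensional ℝ W]
    [AddCommGroup U] [Module ℝ U] [FiniteDimensional ℝ U] {φ : W ⊗[ℝ] U →ₗ[ℝ] ℝ}
    {M : W ⊗[ℝ] U →ₗ[ℝ] W ⊗[ℝ] U →ₗ[ℝ] W ⊗[ℝ] U}
    (hM : ∀ (u u' : W) (v v' : U), M (u ⊗ₜ[ℝ] v) (u' ⊗ₜ[ℝ] v') =
      φ (u ⊗ₜ[ℝ] v') • (u' ⊗ₜ[ℝ] v) + φ (u' ⊗ₜ[ℝ] v) • (u ⊗ₜ[ℝ] v'))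
    (u' : W) (v' : U) :
    LinearMap.trace ℝ (W ⊗[ℝ] U) (M.flip (u' ⊗ₜ[ℝ] v')) =
      ((Module.finrank ℝ W + Module.finrank ℝ U : ℕ) : ℝ) * φ (u' ⊗ₜ[ℝ] v') := by
  have h : M.flip (u' ⊗ₜ[ℝ] v') =
      TensorProduct.map ((φ ∘ₗ (TensorProduct.mk ℝ W U).flip v').smulRight u') LinearMap.id +
      TensorProduct.map LinearMap.id ((φ ∘ₗ TensorProduct.mk ℝ W U u').smulRight v') := by
    ext a b
    simp [hM, TensorProduct.smul_tmul']
  rw [h, map_add, LinearMap.trace_tensorProduct', LinearMap.trace_tensorProduct',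
    LinearMap.trace_smulRight, LinearMap.trace_smulRight, LinearMap.trace_id, LinearMap.trace_id]
  simp only [LinearMap.comp_apply, LinearMap.flip_apply, TensorProduct.mk_apply]
  push_cast
  ring

/-- For a bilinear form `B` on `E = W ⊗ U`, the map `k_B` is alternating, satisfies the
first Bianchi identity, and its Ricci tensor is given on pure tensors by
`Ric(k_B)(C⊗D, C'⊗D') = B(C'⊗D, C⊗D') + B(C⊗D', C'⊗D) − (m+r)·B(C⊗D, C'⊗D')`. -/
theorem kB_curvature_and_ricci
    (hm : 1 ≤ Module.finrank ℝ W) (hr : 1 ≤ Module.finrank ℝ U)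
    (μ : (W ⊗[ℝ] U →ₗ[ℝ] ℝ) →ₗ[ℝ]
      (W ⊗[ℝ] U →ₗ[ℝ] W ⊗[ℝ] U →ₗ[ℝ] W ⊗[ℝ] U))
    (hμ : ∀ (φ : W ⊗[ℝ] U →ₗ[ℝ] ℝ) (u u' : W) (v v' : U),
      μ φ (u ⊗ₜ[ℝ] v) (u' ⊗ₜ[ℝ] v') =
        φ (u ⊗ₜ[ℝ] v') • (u' ⊗ₜ[ℝ] v) + φ (u' ⊗ₜ[ℝ] v) • (u ⊗ₜ[ℝ] v'))
    (B : W ⊗[ℝ] U →ₗ[ℝ] W ⊗[ℝ] U →ₗ[ℝ] ℝ) :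
    (∀ x y : W ⊗[ℝ] U, kB μ B x y = - kB μ B y x) ∧
    (∀ x y z : W ⊗[ℝ] U, kB μ B x y z + kB μ B y z x + kB μ B z x y = 0) ∧
    (∀ (C C' : W) (D D' : U),
      ricciKB μ B (C ⊗ₜ[ℝ] D) (C' ⊗ₜ[ℝ] D') =
        B (C' ⊗ₜ[ℝ] D) (C ⊗ₜ[ℝ] D') + B (C ⊗ₜ[ℝ] D') (C' ⊗ₜ[ℝ] D) -
          ((Module.finrank ℝ W + Module.finrank ℝ U : ℕ) : ℝ) *
            B (C ⊗ₜ[ℝ] D) (C' ⊗ₜ[ℝ] D')) := by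
  refine ⟨fun x y => by simp [kB], fun x y z => ?_, fun C C' D D' => ?_⟩
  · simp only [kB, LinearMap.sub_apply]
    rw [apply_comm_of_tmul (hμ (B x)) y z, apply_comm_of_tmul (hμ (B y)) x z,
      apply_comm_of_tmul (hμ (B z)) y x]
    abel
  · rw [← trace_flip_apply_tmul (hμ (B (C ⊗ₜ[ℝ] D))) C' D',
      ← B.flip_apply (C ⊗ₜ[ℝ] D') (C' ⊗ₜ[ℝ] D), ← B.flip_apply (C' ⊗ₜ[ℝ] D) (C ⊗ₜ[ℝ] D'),
      ← LinearMap.trace_smulRight (B.flip (C ⊗ₜ[ℝ] D')) (C' ⊗ₜ[ℝ] D),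
      ← LinearMap.trace_smulRight (B.flip (C' ⊗ₜ[ℝ] D)) (C ⊗ₜ[ℝ] D'),
      ← map_add, ← map_sub, ricciKB]
    congr 1
    refine LinearMap.ext fun z => ?_
    simp [kB, hμ]

end
end

section
/- Assume m + r > 2. Then the linear map P on the space of bilinear forms on E = W ⊗ U, defined on pure tensors by P(B)(C⊗D, C'⊗D') = B(C'⊗D, C⊗D') + B(C⊗D', C'⊗D) − (m+r)·B(C⊗D, C'⊗D'), is a linear automorphism (bijective) of the space of bilinear forms on E. -/
open scoped TensorProduct

/-- For `E = W ⊗ U` with `m + r > 2` (`m = dim W`, `r = dim U`), the linear operator `P`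
on bilinear forms on `E` determined on pure tensors by
`P(B)(C⊗D, C'⊗D') = B(C'⊗D, C⊗D') + B(C⊗D', C'⊗D) − (m+r)·B(C⊗D, C'⊗D')`
is bijective. -/
theorem P_bijective {W U : Type*}
    [AddCommGroup W] [Module ℝ W] [FiniteDimensional ℝ W]
    [AddCommGroup U] [Module ℝ U] [FiniteDimensional ℝ U]
    (hm : 1 ≤ Module.finrank ℝ W) (hr : 1 ≤ Module.finrank ℝ U)
    (hmr : 2 < Module.finrank ℝ W + Module.finrank ℝ U)
    (P : (W ⊗[ℝ] U →ₗ[ℝ] W ⊗[ℝ] U →ₗ[ℝ] ℝ) →ₗ[ℝ]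
      (W ⊗[ℝ] U →ₗ[ℝ] W ⊗[ℝ] U →ₗ[ℝ] ℝ))
    (hP : ∀ (B : W ⊗[ℝ] U →ₗ[ℝ] W ⊗[ℝ] U →ₗ[ℝ] ℝ) (C C' : W) (D D' : U),
      P B (C ⊗ₜ[ℝ] D) (C' ⊗ₜ[ℝ] D') =
        B (C' ⊗ₜ[ℝ] D) (C ⊗ₜ[ℝ] D') + B (C ⊗ₜ[ℝ] D') (C' ⊗ₜ[ℝ] D) -
          ((Module.finrank ℝ W + Module.finrank ℝ U : ℕ) : ℝ) *
            B (C ⊗ₜ[ℝ] D) (C' ⊗ₜ[ℝ] D')) :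
    Function.Bijective P := by
  suffices h : Function.Injective P from
    ⟨h, (LinearMap.injective_iff_surjective (K := ℝ) (V := W ⊗[ℝ] U →ₗ[ℝ] W ⊗[ℝ] U →ₗ[ℝ] ℝ) (f := P)).mp h⟩
  rw [injective_iff_map_eq_zero]
  intro B hB
  apply TensorProduct.ext'
  intro C D
  apply TensorProduct.ext'
  intro C' D'
  have h₁ := hP B C C' D D'
  have h₂ := hP B C' C D D'
  have h₃ := hP B C C' D' D
  have h₄ := hP B C' C D' D
  simp only [hB, LinearMap.zero_apply] at h₁ h₂ h₃ h₄ ⊢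
  have hn : (2 : ℝ) < ((Module.finrank ℝ W + Module.finrank ℝ U : ℕ) : ℝ) := by
    exact_mod_cast hmr
  generalize ((Module.finrank ℝ W + Module.finrank ℝ U : ℕ) : ℝ) = n at *
  have hpos : n ^ 2 - 4 ≠ 0 := by nlinarith
  have hne : n ≠ 0 := by linarith
  refine (mul_eq_zero.mp (?_ : (n * (n ^ 2 - 4)) * B (C ⊗ₜ[ℝ] D) (C' ⊗ₜ[ℝ] D') = 0)).resolve_left
    (mul_ne_zero hne hpos)
  linear_combination (n ^ 2 - 2) * h₁ + n * h₂ + n * h₃ + 2 * h₄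
end

section
/- Let V be a finite-dimensional complex vector space with dim_ℂ V = 2m for some integer m ≥ 3. Let J₁, J₂, J₃ be ℂ-linear endomorphisms of V satisfying the quaternion relations J_α² = −Id and J_α J_β = J_γ = −J_β J_α for every cyclic permutation (α,β,γ) of (1,2,3). Let R : V × V → End_ℝ(V) be an ℝ-bilinear alternating map satisfying the first Bianchi identity R(x,y)z + R(y,z)x + R(z,x)y = 0, and suppose that for all x, y ∈ V the endomorphism R(x,y) can be written as A + c₁J₁ + c₂J₂ + c₃J₃, where A is a ℂ-linear endomorphism of V commuting with J₁, J₂ and J₃ and c₁, c₂, c₃ are complex scalars (all depending on x and y). If the Ricci tensor Ric(x,y) := tr_ℝ(z ↦ R(z,x)y) vanishes identically, then R(x,y) commutes with each of J₁, J₂, J₃ for all x, y ∈ V. -/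
open Module

section Algebra

variable {E : Type*} [AddCommGroup E] [Module ℂ E]

/-- If `v₁, v₂, v₃` is an eigenvector with eigenvalue `m` of the curl operator attached to operators
satisfying the `𝔰𝔲(2)` relations, then each `vᵢ` is an eigenvector of the Casimir operator. -/
theorem casimir_eigenvector_of_curl_eigenvector {m : ℕ} {L₁ L₂ L₃ : End ℂ E}
    (h12 : L₁ * L₂ - L₂ * L₁ = -(2 : ℂ) • L₃) (h23 : L₂ * L₃ - L₃ * L₂ = -(2 : ℂ) • L₁)
    (h31 : L₃ * L₁ - L₁ * L₃ = -(2 : ℂ) • L₂) {v₁ v₂ v₃ : E}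
    (e₁ : (m : ℂ) • v₁ = L₂ v₃ - L₃ v₂) (e₂ : (m : ℂ) • v₂ = L₃ v₁ - L₁ v₃)
    (e₃ : (m : ℂ) • v₃ = L₁ v₂ - L₂ v₁) :
    (L₁ * L₁ + L₂ * L₂ + L₃ * L₃) v₁ = (-(m * (m + 2)) : ℂ) • v₁ := by
  have c12 (v : E) : L₁ (L₂ v) - L₂ (L₁ v) = -(2 : ℂ) • L₃ v := by
    simpa using LinearMap.congr_fun h12 v
  have c23 (v : E) : L₂ (L₃ v) - L₃ (L₂ v) = -(2 : ℂ) • L₁ v := by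
    simpa using LinearMap.congr_fun h23 v
  have c31 (v : E) : L₃ (L₁ v) - L₁ (L₃ v) = -(2 : ℂ) • L₂ v := by
    simpa using LinearMap.congr_fun h31 v
  have apply_eigen (L : End ℂ E) {v a b : E} (h : (m : ℂ) • v = a - b) :
      (m : ℂ) • L v = L a - L b := by rw [← map_smul, h, map_sub]
  have div_eq : L₁ v₁ + L₂ v₂ + L₃ v₃ = 0 := by
    have hm : (m + 2 : ℂ) ≠ 0 := by exact_mod_cast (by omega : m + 2 ≠ 0)
    refine (smul_eq_zero.mp ?_).resolve_left hm
    linear_combination (norm := module) apply_eigen L₁ e₁ + apply_eigen L₂ e₂ + apply_eigen L₃ e₃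
      + c12 v₃ + c23 v₁ + c31 v₂
  have hdiv : L₁ (L₁ v₁) + L₁ (L₂ v₂) + L₁ (L₃ v₃) = 0 := by
    rw [← map_add, ← map_add, div_eq, map_zero]
  simp only [LinearMap.add_apply, Module.End.mul_apply]
  linear_combination (norm := module) hdiv + (m + 2 : ℂ) • e₁ + apply_eigen L₂ e₃ - apply_eigen L₃ e₂
    - c12 v₂ + c31 v₃

/-- The operator `-3p - 3q + 2Qpq`, for commuting projections `p, q` and a commuting operator `Q`
with `Q ^ 2 = 2Q + 3`, has no eigenvalues outside `{0, -3, -8}`. -/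
theorem eq_zero_of_casimir_eigenvector {p q Q : End ℂ E} (hp : p * p = p) (hq : q * q = q)
    (hpq : p * q = q * p) (hQp : Q * p = p * Q) (hQq : Q * q = q * Q)
    (hQ : Q * Q = (2 : ℂ) • Q + (3 : ℂ) • 1) {c : ℂ} (h0 : c ≠ 0) (h3 : c + 3 ≠ 0)
    (h8 : c + 8 ≠ 0) {v : E}
    (hv : -(3 : ℂ) • p v - (3 : ℂ) • q v + (2 : ℂ) • Q (p (q v)) = c • v) : v = 0 := by
  have hp' (v : E) : p (p v) = p v := LinearMap.congr_fun hp v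
  have hq' (v : E) : q (q v) = q v := LinearMap.congr_fun hq v
  have hpq' (v : E) : q (p v) = p (q v) := (LinearMap.congr_fun hpq v).symm
  have hQp' (v : E) : p (Q v) = Q (p v) := (LinearMap.congr_fun hQp v).symm
  have hQq' (v : E) : q (Q v) = Q (q v) := (LinearMap.congr_fun hQq v).symm
  have hQ' (v : E) : Q (Q v) = (2 : ℂ) • Q v + (3 : ℂ) • v := by
    simpa using LinearMap.congr_fun hQ v
  have hpv := congrArg p hv
  have hqv := congrArg q hv
  have hpqv := congrArg (fun w => p (q w)) hv
  simp only [map_add, map_sub, map_smul, hp', hq', hpq', hQp', hQq'] at hpv hqv hpqv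
  have hQpqv := congrArg Q hpqv
  simp only [map_add, map_sub, map_smul, hQ'] at hQpqv
  have w0 : p (q v) = 0 := by
    refine (smul_eq_zero.mp (?_ : (c * (c + 8)) • p (q v) = 0)).resolve_left (mul_ne_zero h0 h8)
    linear_combination (norm := module) -(c + 2) • hpqv - (2 : ℂ) • hQpqv
  rw [w0] at hpv hqv hv
  simp only [map_zero, smul_zero, add_zero, sub_zero] at hpv hqv hv
  have p0 : p v = 0 := by
    refine (smul_eq_zero.mp (?_ : (c + 3) • p v = 0)).resolve_left h3
    linear_combination (norm := module) -hpv
  have q0 : q v = 0 := by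
    refine (smul_eq_zero.mp (?_ : (c + 3) • q v = 0)).resolve_left h3
    linear_combination (norm := module) -hqv
  rw [p0, q0] at hv
  exact (smul_eq_zero.mp (by simpa using hv.symm)).resolve_left h0

end Algebra

section ComplexTrace

variable {V : Type*} [AddCommGroup V] [Module ℂ V]

/-- The `ℂ`-linear functional on `ℝ`-linear endomorphisms with real part the real trace. -/
noncomputable def complexTrace (V : Type*) [AddCommGroup V] [Module ℂ V] :
    (V →ₗ[ℝ] V) →ₗ[ℂ] ℂ :=
  Module.Dual.extendRCLike (𝕜 := ℂ) (LinearMap.trace ℝ V)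

theorem complexTrace_apply (T : V →ₗ[ℝ] V) :
    complexTrace V T = LinearMap.trace ℝ V T - Complex.I * LinearMap.trace ℝ V (Complex.I • T) :=
  rfl

theorem complexTrace_comp_comm (J : V →ₗ[ℂ] V) (T : V →ₗ[ℝ] V) :
    complexTrace V (J.restrictScalars ℝ ∘ₗ T) = complexTrace V (T ∘ₗ J.restrictScalars ℝ) := by
  have h : Complex.I • (J.restrictScalars ℝ ∘ₗ T) = J.restrictScalars ℝ ∘ₗ (Complex.I • T) := by
    ext; simp
  rw [complexTrace_apply, complexTrace_apply, h, ← LinearMap.smul_comp]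
  congr 2
  · rw [← Module.End.mul_eq_comp, LinearMap.trace_mul_comm]; rfl
  · rw [← Module.End.mul_eq_comp, LinearMap.trace_mul_comm]; rfl

variable [FiniteDimensional ℂ V]

theorem trace_I_smul : LinearMap.trace ℝ V (Complex.I • (LinearMap.id : V →ₗ[ℝ] V)) = 0 := by
  let b := (Module.finBasis ℂ V).equivFun
  let e : V ≃ₗ[ℝ] V := (b.restrictScalars ℝ).trans
    ((LinearEquiv.piCongrRight fun _ => Complex.conjAe.toLinearEquiv).trans
      (b.restrictScalars ℝ).symm)
  have h : e.conj (Complex.I • LinearMap.id) = -(Complex.I • (LinearMap.id : V →ₗ[ℝ] V)) := by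
    ext x
    obtain ⟨x, rfl⟩ := e.surjective x
    simp only [LinearEquiv.conj_apply_apply, LinearEquiv.symm_apply_apply]
    apply b.injective
    ext i
    simp [e]
  have := LinearMap.trace_conj' (R := ℝ) (Complex.I • (LinearMap.id : V →ₗ[ℝ] V)) e
  rw [h, map_neg] at this
  linarith

theorem complexTrace_id : complexTrace V LinearMap.id = (2 * finrank ℂ V : ℕ) := by
  have : FiniteDimensional ℝ V := FiniteDimensional.complexToReal V
  rw [complexTrace_apply, trace_I_smul, LinearMap.trace_id, finrank_real_of_complex]
  simp

theorem complexTrace_smulRight (φ : V →ₗ[ℝ] ℂ) (v : V) :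
    complexTrace V (φ.smulRight v) = φ v - Complex.I * φ (Complex.I • v) := by
  have : FiniteDimensional ℝ V := FiniteDimensional.complexToReal V
  have h : φ.smulRight v = (Complex.reLm ∘ₗ φ).smulRight v
      + (Complex.imLm ∘ₗ φ).smulRight (Complex.I • v) := by
    ext z
    conv_lhs => rw [LinearMap.smulRight_apply, ← Complex.re_add_im (φ z), add_smul, mul_smul]
    simp
  have h' : Complex.I • (φ.smulRight v) = (Complex.reLm ∘ₗ φ).smulRight (Complex.I • v)
      - (Complex.imLm ∘ₗ φ).smulRight v := by
    ext z
    have hI : Complex.I * φ z = (φ z).re * Complex.I - (φ z).im := by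
      apply Complex.ext <;> simp
    rw [LinearMap.smul_apply, LinearMap.smulRight_apply, smul_smul, hI, sub_smul, mul_smul]
    simp
  rw [complexTrace_apply, h', h]
  simp only [map_add, map_sub, LinearMap.trace_smulRight]
  apply Complex.ext <;> simp

end ComplexTrace

section BilinearForms

variable {V : Type*} [AddCommGroup V] [Module ℂ V]

/-- Pullback of a complex-valued real bilinear form along a pair of real linear maps. -/
noncomputable def pullback (S T : V →ₗ[ℝ] V) : End ℂ (V →ₗ[ℝ] V →ₗ[ℝ] ℂ) where
  toFun ω := ω.compl₁₂ S T
  map_add' _ _ := rfl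
  map_smul' _ _ := rfl

@[simp] theorem pullback_apply (S T : V →ₗ[ℝ] V) (ω : V →ₗ[ℝ] V →ₗ[ℝ] ℂ) (x y : V) :
    pullback S T ω x y = ω (S x) (T y) := rfl

/-- The projection of bilinear forms onto those that are `ℂ`-linear in the first variable. -/
noncomputable def holLeft (V : Type*) [AddCommGroup V] [Module ℂ V] :
    End ℂ (V →ₗ[ℝ] V →ₗ[ℝ] ℂ) :=
  (1 / 2 : ℂ) • (1 - Complex.I • pullback (Complex.I • LinearMap.id) LinearMap.id)

@[simp] theorem holLeft_apply (ω : V →ₗ[ℝ] V →ₗ[ℝ] ℂ) (x y : V) :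
    holLeft V ω x y = 1 / 2 * (ω x y - Complex.I * ω (Complex.I • x) y) := rfl

/-- The projection of bilinear forms onto those that are `ℂ`-linear in the second variable. -/
noncomputable def holRight (V : Type*) [AddCommGroup V] [Module ℂ V] :
    End ℂ (V →ₗ[ℝ] V →ₗ[ℝ] ℂ) :=
  (1 / 2 : ℂ) • (1 - Complex.I • pullback LinearMap.id (Complex.I • LinearMap.id))

@[simp] theorem holRight_apply (ω : V →ₗ[ℝ] V →ₗ[ℝ] ℂ) (x y : V) :
    holRight V ω x y = 1 / 2 * (ω x y - Complex.I * ω x (Complex.I • y)) := rfl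

/-- The action of `J` as a derivation on bilinear forms, restricted to the variables in which the
form is `ℂ`-linear. -/
noncomputable def holDerivation (J : V →ₗ[ℂ] V) : End ℂ (V →ₗ[ℝ] V →ₗ[ℝ] ℂ) :=
  pullback (J.restrictScalars ℝ) LinearMap.id * holLeft V
    + pullback LinearMap.id (J.restrictScalars ℝ) * holRight V

@[simp] theorem holDerivation_apply (J : V →ₗ[ℂ] V) (ω : V →ₗ[ℝ] V →ₗ[ℝ] ℂ) (x y : V) :
    holDerivation J ω x y = 1 / 2 * (ω (J x) y - Complex.I * ω (Complex.I • J x) y)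
      + 1 / 2 * (ω x (J y) - Complex.I * ω x (Complex.I • J y)) := rfl

theorem I_smul_I_smul (x : V) : Complex.I • Complex.I • x = -x := by
  rw [smul_smul, Complex.I_mul_I, neg_one_smul]

theorem holLeft_mul_self : holLeft V * holLeft V = holLeft V := by
  ext ω x y
  simp only [End.mul_apply, holLeft_apply, I_smul_I_smul, map_neg, LinearMap.neg_apply]
  linear_combination (-1 / 4 * ω x y) * Complex.I_sq

theorem holRight_mul_self : holRight V * holRight V = holRight V := by
  ext ω x y
  simp only [End.mul_apply, holRight_apply, I_smul_I_smul, map_neg]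
  linear_combination (-1 / 4 * ω x y) * Complex.I_sq

theorem holLeft_mul_holRight : holLeft V * holRight V = holRight V * holLeft V := by
  ext ω x y
  simp only [End.mul_apply, holLeft_apply, holRight_apply]
  ring

theorem holDerivation_commutator {J K L : V →ₗ[ℂ] V} (h : ∀ x, J (K x) = L x)
    (h' : ∀ x, K (J x) = -L x) :
    holDerivation J * holDerivation K - holDerivation K * holDerivation J
      = -(2 : ℂ) • holDerivation L := by
  ext ω x y
  simp only [End.mul_apply, holDerivation_apply, I_smul_I_smul, map_neg, LinearMap.neg_apply,
    LinearMap.sub_apply, LinearMap.smul_apply, smul_eq_mul, map_smul, h, h', smul_neg]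
  linear_combination (1 / 2 * (ω (L x) y + ω x (L y))) * Complex.I_sq

/-- The operator `∑ Jₐ ⊗ Jₐ` on bilinear forms. -/
noncomputable def pullbackSum (J₁ J₂ J₃ : V →ₗ[ℂ] V) : End ℂ (V →ₗ[ℝ] V →ₗ[ℝ] ℂ) :=
  pullback (J₁.restrictScalars ℝ) (J₁.restrictScalars ℝ)
    + pullback (J₂.restrictScalars ℝ) (J₂.restrictScalars ℝ)
    + pullback (J₃.restrictScalars ℝ) (J₃.restrictScalars ℝ)

@[simp] theorem pullbackSum_apply (J₁ J₂ J₃ : V →ₗ[ℂ] V) (ω : V →ₗ[ℝ] V →ₗ[ℝ] ℂ) (x y : V) :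
    pullbackSum J₁ J₂ J₃ ω x y = ω (J₁ x) (J₁ y) + ω (J₂ x) (J₂ y) + ω (J₃ x) (J₃ y) := rfl

theorem pullbackSum_mul_holLeft (J₁ J₂ J₃ : V →ₗ[ℂ] V) :
    pullbackSum J₁ J₂ J₃ * holLeft V = holLeft V * pullbackSum J₁ J₂ J₃ := by
  ext ω x y
  simp only [End.mul_apply, holLeft_apply, pullbackSum_apply, map_smul]
  ring

theorem pullbackSum_mul_holRight (J₁ J₂ J₃ : V →ₗ[ℂ] V) :
    pullbackSum J₁ J₂ J₃ * holRight V = holRight V * pullbackSum J₁ J₂ J₃ := by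
  ext ω x y
  simp only [End.mul_apply, holRight_apply, pullbackSum_apply, map_smul]
  ring

/-- The quaternion relations for three linear endomorphisms. -/
structure IsQuaternionTriple (J₁ J₂ J₃ : V →ₗ[ℂ] V) : Prop where
  sq₁ (x : V) : J₁ (J₁ x) = -x
  sq₂ (x : V) : J₂ (J₂ x) = -x
  sq₃ (x : V) : J₃ (J₃ x) = -x
  mul₁₂ (x : V) : J₁ (J₂ x) = J₃ x
  mul₂₃ (x : V) : J₂ (J₃ x) = J₁ x
  mul₃₁ (x : V) : J₃ (J₁ x) = J₂ x
  mul₂₁ (x : V) : J₂ (J₁ x) = -J₃ x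
  mul₃₂ (x : V) : J₃ (J₂ x) = -J₁ x
  mul₁₃ (x : V) : J₁ (J₃ x) = -J₂ x

namespace IsQuaternionTriple

variable {J₁ J₂ J₃ : V →ₗ[ℂ] V}

theorem rotate (h : IsQuaternionTriple J₁ J₂ J₃) : IsQuaternionTriple J₂ J₃ J₁ :=
  ⟨h.sq₂, h.sq₃, h.sq₁, h.mul₂₃, h.mul₃₁, h.mul₁₂, h.mul₃₂, h.mul₁₃, h.mul₂₁⟩

theorem pullbackSum_mul_self (h : IsQuaternionTriple J₁ J₂ J₃) :
    pullbackSum J₁ J₂ J₃ * pullbackSum J₁ J₂ J₃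
      = (2 : ℂ) • pullbackSum J₁ J₂ J₃ + (3 : ℂ) • 1 := by
  ext ω x y
  simp only [End.mul_apply, pullbackSum_apply, h.sq₁, h.sq₂, h.sq₃, h.mul₁₂, h.mul₂₃, h.mul₃₁,
    h.mul₂₁, h.mul₃₂, h.mul₁₃, map_neg, LinearMap.neg_apply, LinearMap.add_apply,
    LinearMap.smul_apply, End.one_apply, smul_eq_mul]
  ring

theorem casimir_eq (h : IsQuaternionTriple J₁ J₂ J₃) :
    holDerivation J₁ * holDerivation J₁ + holDerivation J₂ * holDerivation J₂
        + holDerivation J₃ * holDerivation J₃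
      = -(3 : ℂ) • holLeft V - (3 : ℂ) • holRight V
        + (2 : ℂ) • (pullbackSum J₁ J₂ J₃ * (holLeft V * holRight V)) := by
  ext ω x y
  simp only [End.mul_apply, holDerivation_apply, pullbackSum_apply, holLeft_apply, holRight_apply,
    I_smul_I_smul, h.sq₁, h.sq₂, h.sq₃, map_neg, map_smul, LinearMap.neg_apply,
    LinearMap.add_apply, LinearMap.sub_apply, LinearMap.smul_apply, smul_eq_mul, smul_neg]
  linear_combination (3 / 2 * ω x y) * Complex.I_sq

/-- The curl operator attached to a quaternion triple has no eigenvalue `m ≥ 3`. -/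
theorem eq_zero_of_curl_eigenvector (h : IsQuaternionTriple J₁ J₂ J₃) {m : ℕ} (hm : 3 ≤ m)
    {ω₁ ω₂ ω₃ : V →ₗ[ℝ] V →ₗ[ℝ] ℂ}
    (e₁ : (m : ℂ) • ω₁ = holDerivation J₂ ω₃ - holDerivation J₃ ω₂)
    (e₂ : (m : ℂ) • ω₂ = holDerivation J₃ ω₁ - holDerivation J₁ ω₃)
    (e₃ : (m : ℂ) • ω₃ = holDerivation J₁ ω₂ - holDerivation J₂ ω₁) : ω₁ = 0 := by
  have key := casimir_eigenvector_of_curl_eigenvector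
    (holDerivation_commutator h.mul₁₂ h.mul₂₁) (holDerivation_commutator h.mul₂₃ h.mul₃₂)
    (holDerivation_commutator h.mul₃₁ h.mul₁₃) e₁ e₂ e₃
  rw [h.casimir_eq] at key
  have hne (k : ℕ) (hk : k ≤ 8) : (-(m * (m + 2)) + k : ℂ) ≠ 0 := by
    intro hc
    have : ((m * (m + 2) : ℕ) : ℂ) = (k : ℕ) := by
      push_cast
      linear_combination -hc
    have : m * (m + 2) = k := by exact_mod_cast this
    nlinarith
  exact eq_zero_of_casimir_eigenvector holLeft_mul_self holRight_mul_self holLeft_mul_holRight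
    (pullbackSum_mul_holLeft J₁ J₂ J₃) (pullbackSum_mul_holRight J₁ J₂ J₃) h.pullbackSum_mul_self
    (by simpa using hne 0 (by norm_num)) (by simpa using hne 3 (by norm_num))
    (by simpa using hne 8 le_rfl) key

end IsQuaternionTriple

end BilinearForms

section Curvature

variable {V : Type*} [AddCommGroup V] [Module ℂ V]

/-- The real bilinear form `(x, y) ↦ tr (J ∘ R x y)`. -/
noncomputable def traceForm (R : V →ₗ[ℝ] V →ₗ[ℝ] End ℝ V) (J : V →ₗ[ℂ] V) :
    V →ₗ[ℝ] V →ₗ[ℝ] ℂ :=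
  LinearMap.compr₂ R
    ((complexTrace V).restrictScalars ℝ ∘ₗ LinearMap.llcomp ℝ V V V (J.restrictScalars ℝ))

theorem traceForm_apply (R : V →ₗ[ℝ] V →ₗ[ℝ] End ℝ V) (J : V →ₗ[ℂ] V) (x y : V) :
    traceForm R J x y = complexTrace V (J.restrictScalars ℝ ∘ₗ R x y) := rfl

/-- The endomorphism `z ↦ R z x y` whose trace is the Ricci tensor. -/
noncomputable def ricciEndomorphism (R : V →ₗ[ℝ] V →ₗ[ℝ] End ℝ V) (x y : V) : V →ₗ[ℝ] V :=
  LinearMap.flip (R.flip x) y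

@[simp] theorem ricciEndomorphism_apply (R : V →ₗ[ℝ] V →ₗ[ℝ] End ℝ V) (x y z : V) :
    ricciEndomorphism R x y z = R z x y := rfl

theorem complexTrace_ricciEndomorphism {R : V →ₗ[ℝ] V →ₗ[ℝ] End ℝ V}
    (hI : ∀ x y z : V, R x y (Complex.I • z) = Complex.I • R x y z)
    (hric : ∀ x y : V, formalRicci R x y = 0) (x y : V) :
    complexTrace V (ricciEndomorphism R x y) = 0 := by
  have hI' : Complex.I • ricciEndomorphism R x y = ricciEndomorphism R x (Complex.I • y) := by
    ext z
    simp [hI]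
  have h (y : V) : LinearMap.trace ℝ V (ricciEndomorphism R x y) = 0 := hric x y
  rw [complexTrace_apply, hI', h, h]
  simp

namespace IsQuaternionTriple

variable {J₁ J₂ J₃ : V →ₗ[ℂ] V}

theorem complexTrace_eq_zero (h : IsQuaternionTriple J₁ J₂ J₃) :
    complexTrace V (J₁.restrictScalars ℝ) = 0 := by
  have h1 : J₂.restrictScalars ℝ ∘ₗ J₃.restrictScalars ℝ = J₁.restrictScalars ℝ :=
    LinearMap.ext h.mul₂₃
  have h2 : J₃.restrictScalars ℝ ∘ₗ J₂.restrictScalars ℝ = -J₁.restrictScalars ℝ :=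
    LinearMap.ext h.mul₃₂
  have := complexTrace_comp_comm J₂ (J₃.restrictScalars ℝ)
  rw [h1, h2, map_neg] at this
  linear_combination this / 2

/-- The trace of `J₁ ∘ A` vanishes when `A` commutes with the quaternion triple. -/
theorem complexTrace_comp_eq_zero (h : IsQuaternionTriple J₁ J₂ J₃) {A : V →ₗ[ℂ] V}
    (hA₁ : ∀ x, A (J₁ x) = J₁ (A x)) (hA₃ : ∀ x, A (J₃ x) = J₃ (A x)) :
    complexTrace V (J₁.restrictScalars ℝ ∘ₗ A.restrictScalars ℝ) = 0 := by
  have h1 : J₂.restrictScalars ℝ ∘ₗ (J₃.restrictScalars ℝ ∘ₗ A.restrictScalars ℝ)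
      = J₁.restrictScalars ℝ ∘ₗ A.restrictScalars ℝ := by
    ext x
    simp [h.mul₂₃]
  have h2 : (J₃.restrictScalars ℝ ∘ₗ A.restrictScalars ℝ) ∘ₗ J₂.restrictScalars ℝ
      = -(J₁.restrictScalars ℝ ∘ₗ A.restrictScalars ℝ) := by
    ext x
    simp [← hA₃, h.mul₃₂, hA₁]
  have := complexTrace_comp_comm J₂ (J₃.restrictScalars ℝ ∘ₗ A.restrictScalars ℝ)
  rw [h1, h2, map_neg] at this
  linear_combination this / 2

theorem complexTrace_comp_decomposition [FiniteDimensional ℂ V] (h : IsQuaternionTriple J₁ J₂ J₃) {A : V →ₗ[ℂ] V}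
    (hA₁ : ∀ x, A (J₁ x) = J₁ (A x)) (hA₃ : ∀ x, A (J₃ x) = J₃ (A x)) {T : V →ₗ[ℝ] V}
    {c₁ c₂ c₃ : ℂ} (hT : ∀ x, T x = A x + c₁ • J₁ x + c₂ • J₂ x + c₃ • J₃ x) :
    complexTrace V (J₁.restrictScalars ℝ ∘ₗ T) = -(2 * finrank ℂ V) * c₁ := by
  have h1 : J₁.restrictScalars ℝ ∘ₗ T = J₁.restrictScalars ℝ ∘ₗ A.restrictScalars ℝ
      - c₁ • LinearMap.id + c₂ • J₃.restrictScalars ℝ - c₃ • J₂.restrictScalars ℝ := by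
    ext x
    simp only [LinearMap.comp_apply, LinearMap.coe_restrictScalars, hT, map_add, map_smul, h.sq₁,
      h.mul₁₂, h.mul₁₃, LinearMap.sub_apply, LinearMap.add_apply, LinearMap.smul_apply,
      LinearMap.id_apply]
    module
  rw [h1, map_sub, map_add, map_sub, map_smul, map_smul, map_smul, complexTrace_id,
    h.complexTrace_comp_eq_zero hA₁ hA₃, h.rotate.complexTrace_eq_zero,
    h.rotate.rotate.complexTrace_eq_zero]
  simp
  ring

end IsQuaternionTriple

/-- The trace of the Bianchi identity composed with `J₁`, for a Ricci-flat curvature tensor. -/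
theorem curl_eq_of_ricci_flat [FiniteDimensional ℂ V] {R : V →ₗ[ℝ] V →ₗ[ℝ] End ℝ V}
    {J₁ J₂ J₃ : V →ₗ[ℂ] V} {ω₁ ω₂ ω₃ : V →ₗ[ℝ] V →ₗ[ℝ] ℂ} {m : ℕ}
    (halt₂ : ∀ x y, ω₂ x y = -ω₂ y x) (halt₃ : ∀ x y, ω₃ x y = -ω₃ y x)
    (hbianchi : ∀ x y z : V, R x y z + R y z x + R z x y = 0)
    (halt : ∀ x y : V, R x y = -R y x)
    (htr : ∀ x y, complexTrace V (ricciEndomorphism R x y) = 0)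
    (hcomm : ∀ x y z, R x y (J₁ z)
      = J₁ (R x y z) + (2 : ℂ) • (ω₃ x y • J₂ z - ω₂ x y • J₃ z))
    (hω : ∀ x y, traceForm R J₁ x y = -(4 * m) * ω₁ x y) :
    (m : ℂ) • ω₁ = holDerivation J₂ ω₃ - holDerivation J₃ ω₂ := by
  have hJ (x y : V) : J₁.restrictScalars ℝ ∘ₗ ricciEndomorphism R x y
      = ricciEndomorphism R x (J₁ y)
        - (2 : ℂ) • ((ω₃.flip x).smulRight (J₂ y) - (ω₂.flip x).smulRight (J₃ y)) := by
    ext z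
    simp [hcomm]
  have hB (x y : V) : J₁.restrictScalars ℝ ∘ₗ R x y
      = J₁.restrictScalars ℝ ∘ₗ ricciEndomorphism R y x
        - J₁.restrictScalars ℝ ∘ₗ ricciEndomorphism R x y := by
    ext z
    have : R x y z = R z y x - R z x y := by
      have := hbianchi x y z
      rw [halt y z, LinearMap.neg_apply] at this
      linear_combination (norm := module) this
    simp [this]
  ext x y
  have key := hω x y
  rw [traceForm_apply, hB, hJ, hJ] at key
  simp only [map_sub, map_smul, htr, complexTrace_smulRight, LinearMap.flip_apply,
    smul_eq_mul] at key
  rw [halt₃ (J₂ y) x, halt₃ (Complex.I • J₂ y) x, halt₂ (J₃ y) x,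
    halt₂ (Complex.I • J₃ y) x] at key
  simp only [LinearMap.smul_apply, LinearMap.sub_apply, holDerivation_apply, smul_eq_mul]
  linear_combination key / 4

end Curvature

/-- (Minimal Segre / quaternionic argument.) Let `V` be a complex vector space of
complex dimension `2m`, `m ≥ 3`, with a quaternionic triple `J₁, J₂, J₃` of `ℂ`-linear
endomorphisms. If `R` is a formal curvature tensor on `V` whose values decompose as
`A + c₁J₁ + c₂J₂ + c₃J₃` with `A` `ℂ`-linear commuting with every `J_α` and `c_α ∈ ℂ`,
and the Ricci tensor of `R` vanishes, then every `R(x,y)` commutes with `J₁, J₂, J₃`. -/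
theorem ricci_flat_minimal_segre_reduces {V : Type*} [AddCommGroup V] [Module ℂ V]
    [FiniteDimensional ℂ V] {m : ℕ} (hm : 3 ≤ m)
    (hdim : Module.finrank ℂ V = 2 * m)
    (J₁ J₂ J₃ : V →ₗ[ℂ] V)
    (h11 : J₁ ∘ₗ J₁ = - LinearMap.id) (h22 : J₂ ∘ₗ J₂ = - LinearMap.id)
    (h33 : J₃ ∘ₗ J₃ = - LinearMap.id)
    (h12 : J₁ ∘ₗ J₂ = J₃) (h23 : J₂ ∘ₗ J₃ = J₁) (h31 : J₃ ∘ₗ J₁ = J₂)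
    (h21 : J₂ ∘ₗ J₁ = - J₃) (h32 : J₃ ∘ₗ J₂ = - J₁) (h13 : J₁ ∘ₗ J₃ = - J₂)
    (R : V →ₗ[ℝ] V →ₗ[ℝ] Module.End ℝ V)
    (halt : ∀ x y : V, R x y = - R y x)
    (hbianchi : ∀ x y z : V, R x y z + R y z x + R z x y = 0)
    (hdecomp : ∀ x y : V, ∃ (A : V →ₗ[ℂ] V) (c₁ c₂ c₃ : ℂ),
      A ∘ₗ J₁ = J₁ ∘ₗ A ∧ A ∘ₗ J₂ = J₂ ∘ₗ A ∧ A ∘ₗ J₃ = J₃ ∘ₗ A ∧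
      R x y = (A + c₁ • J₁ + c₂ • J₂ + c₃ • J₃).restrictScalars ℝ)
    (hric : ∀ x y : V, formalRicci R x y = 0) :
    ∀ x y : V,
      R x y ∘ₗ J₁.restrictScalars ℝ = J₁.restrictScalars ℝ ∘ₗ R x y ∧
      R x y ∘ₗ J₂.restrictScalars ℝ = J₂.restrictScalars ℝ ∘ₗ R x y ∧
      R x y ∘ₗ J₃.restrictScalars ℝ = J₃.restrictScalars ℝ ∘ₗ R x y := by
  have hJ : IsQuaternionTriple J₁ J₂ J₃ :=
    ⟨LinearMap.congr_fun h11, LinearMap.congr_fun h22, LinearMap.congr_fun h33,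
      LinearMap.congr_fun h12, LinearMap.congr_fun h23, LinearMap.congr_fun h31,
      LinearMap.congr_fun h21, LinearMap.congr_fun h32, LinearMap.congr_fun h13⟩
  have hm0 : (m : ℂ) ≠ 0 := by exact_mod_cast (by omega : m ≠ 0)
  let ω (J : V →ₗ[ℂ] V) : V →ₗ[ℝ] V →ₗ[ℝ] ℂ := (-(4 * m : ℂ)⁻¹) • traceForm R J
  have hω (J : V →ₗ[ℂ] V) (x y : V) : traceForm R J x y = -(4 * m) * ω J x y := by
    simp only [ω, LinearMap.smul_apply, smul_eq_mul]
    field_simp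
  have hωalt (J : V →ₗ[ℂ] V) (x y : V) : ω J x y = -ω J y x := by
    simp only [ω, LinearMap.smul_apply, traceForm_apply, halt x y, LinearMap.comp_neg, map_neg,
      smul_neg]
  have hdec (x y : V) : ∃ A : V →ₗ[ℂ] V, (∀ z, A (J₁ z) = J₁ (A z)) ∧
      (∀ z, A (J₂ z) = J₂ (A z)) ∧ (∀ z, A (J₃ z) = J₃ (A z)) ∧
      ∀ z, R x y z = A z + ω J₁ x y • J₁ z + ω J₂ x y • J₂ z + ω J₃ x y • J₃ z := by
    obtain ⟨A, c₁, c₂, c₃, hA₁, hA₂, hA₃, hR⟩ := hdecomp x y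
    replace hA₁ := LinearMap.congr_fun hA₁
    replace hA₂ := LinearMap.congr_fun hA₂
    replace hA₃ := LinearMap.congr_fun hA₃
    replace hR (z : V) : R x y z = A z + c₁ • J₁ z + c₂ • J₂ z + c₃ • J₃ z :=
      LinearMap.congr_fun hR z
    have coeff {J : V →ₗ[ℂ] V} {c : ℂ}
        (h : complexTrace V (J.restrictScalars ℝ ∘ₗ R x y) = -(2 * finrank ℂ V) * c) :
        ω J x y = c := by
      rw [← traceForm_apply, hω, hdim] at h
      push_cast at h
      apply mul_left_cancel₀ hm0
      linear_combination -h / 4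
    refine ⟨A, hA₁, hA₂, hA₃, fun z => ?_⟩
    rw [coeff (hJ.complexTrace_comp_decomposition hA₁ hA₃ hR),
      coeff (hJ.rotate.complexTrace_comp_decomposition hA₂ hA₁ (c₂ := c₃) (c₃ := c₁)
        fun z => by rw [hR]; abel),
      coeff (hJ.rotate.rotate.complexTrace_comp_decomposition hA₃ hA₂ (c₂ := c₁) (c₃ := c₂)
        fun z => by rw [hR]; abel), hR]
  have htr := complexTrace_ricciEndomorphism (R := R) (fun x y z => by
    obtain ⟨A, -, -, -, hR⟩ := hdec x y
    simp only [hR, map_smul]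
    module) hric
  have e₁ := curl_eq_of_ricci_flat (J₁ := J₁) (J₂ := J₂) (J₃ := J₃)
    (hωalt J₂) (hωalt J₃) hbianchi halt htr
    (fun x y z => by
      obtain ⟨A, hA, -, -, hR⟩ := hdec x y
      simp only [hR, map_add, map_smul, hA, hJ.mul₁₂, hJ.mul₁₃, hJ.mul₂₁, hJ.mul₃₁]
      module) (hω J₁)
  have e₂ := curl_eq_of_ricci_flat (J₁ := J₂) (J₂ := J₃) (J₃ := J₁)
    (hωalt J₃) (hωalt J₁) hbianchi halt htr
    (fun x y z => by
      obtain ⟨A, -, hA, -, hR⟩ := hdec x y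
      simp only [hR, map_add, map_smul, hA, hJ.mul₁₂, hJ.mul₂₃, hJ.mul₂₁, hJ.mul₃₂]
      module) (hω J₂)
  have e₃ := curl_eq_of_ricci_flat (J₁ := J₃) (J₂ := J₁) (J₃ := J₂)
    (hωalt J₁) (hωalt J₂) hbianchi halt htr
    (fun x y z => by
      obtain ⟨A, -, -, hA, hR⟩ := hdec x y
      simp only [hR, map_add, map_smul, hA, hJ.mul₁₃, hJ.mul₂₃, hJ.mul₃₁, hJ.mul₃₂]
      module) (hω J₃)
  have z₁ := hJ.eq_zero_of_curl_eigenvector hm e₁ e₂ e₃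
  have z₂ := hJ.rotate.eq_zero_of_curl_eigenvector hm e₂ e₃ e₁
  have z₃ := hJ.rotate.rotate.eq_zero_of_curl_eigenvector hm e₃ e₁ e₂
  intro x y
  obtain ⟨A, hA₁, hA₂, hA₃, hR⟩ := hdec x y
  simp only [z₁, z₂, z₃, LinearMap.zero_apply, zero_smul, add_zero] at hR
  refine ⟨?_, ?_, ?_⟩ <;> ext z <;> simp [hR, hA₁, hA₂, hA₃]
end

section
/- Let V be a 3-dimensional real vector space with a nondegenerate symmetric bilinear form g, and let R be a formal curvature tensor on V taking values in 𝔰𝔬(V,g), i.e. g(R(x,y)z, w) + g(z, R(x,y)w) = 0 for all x,y,z,w ∈ V. If the Ricci tensor of R vanishes identically, then R = 0. -/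
open Module in
/-- The trace of an endomorphism in a basis orthogonal for `g` without isotropic vectors. -/
theorem trace_eq_sum_div_of_orthogonal {ι V : Type*} [Fintype ι] [AddCommGroup V] [Module ℝ V]
    (g : V →ₗ[ℝ] V →ₗ[ℝ] ℝ) (b : Basis ι ℝ V)
    (hortho : ∀ i j, i ≠ j → g (b i) (b j) = 0) (hne : ∀ i, g (b i) (b i) ≠ 0)
    (f : V →ₗ[ℝ] V) :
    LinearMap.trace ℝ V f = ∑ i, g (f (b i)) (b i) / g (b i) (b i) := by
  classical
  rw [LinearMap.trace_eq_matrix_trace ℝ b, Matrix.trace]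
  refine Finset.sum_congr rfl fun i _ => ?_
  rw [Matrix.diag_apply, LinearMap.toMatrix_apply, eq_div_iff (hne i)]
  conv_rhs => rw [← b.sum_repr (f (b i))]
  rw [map_sum, LinearMap.sum_apply, Finset.sum_eq_single i]
  · simp
  · intro j _ hj
    simp [hortho j i hj]
  · simp

open Module in
/-- A basis orthogonal for a nondegenerate form has no isotropic vector. -/
theorem self_ne_zero_of_orthogonal {ι V : Type*} [AddCommGroup V] [Module ℝ V]
    (g : V →ₗ[ℝ] V →ₗ[ℝ] ℝ) (hg : ∀ x : V, (∀ y : V, g x y = 0) → x = 0) (b : Basis ι ℝ V)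
    (hortho : ∀ i j, i ≠ j → g (b i) (b j) = 0) (i : ι) : g (b i) (b i) ≠ 0 := by
  intro h
  have hzero : g (b i) = 0 := b.ext fun j => by
    by_cases hij : i = j
    · simpa [← hij] using h
    · simpa using hortho i j hij
  exact b.ne_zero i (hg _ fun y => by simp [hzero])

/-- Components antisymmetric in both index pairs, in dimension three, vanish as soon as their
contraction with a nondegenerate diagonal metric `e` does. -/
theorem components_eq_zero_of_contraction_eq_zero (r : Fin 3 → Fin 3 → Fin 3 → Fin 3 → ℝ)
    (e : Fin 3 → ℝ) (he : ∀ i, e i ≠ 0)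
    (hleft : ∀ i j k l, r i j k l = -r j i k l) (hright : ∀ i j k l, r i j k l = -r i j l k)
    (hric : ∀ j k, ∑ i, r i j k i / e i = 0) (i j k l : Fin 3) : r i j k l = 0 := by
  have hdiag_left : ∀ i k l, r i i k l = 0 := fun i k l => by linarith [hleft i i k l]
  have hdiag_right : ∀ i j k, r i j k k = 0 := fun i j k => by linarith [hright i j k k]
  have hsum : ∀ j k, r 0 j k 0 * (e 1 * e 2) + r 1 j k 1 * (e 0 * e 2)
      + r 2 j k 2 * (e 0 * e 1) = 0 := fun j k => by
    have h := hric j k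
    have h0 := he 0
    have h1 := he 1
    have h2 := he 2
    rw [Fin.sum_univ_three] at h
    field_simp at h
    linarith
  have hoff : ∀ i j k, i ≠ j → i ≠ k → j ≠ k → r i j k i = 0 := fun i j k hij hik hjk => by
    have h := hric j k
    rw [Finset.sum_eq_single i] at h
    · simpa [he i] using h
    · intro m _ hm
      obtain rfl | rfl : m = j ∨ m = k := by omega
      · simp [hdiag_left]
      · simp [hdiag_right]
    · simp
  have hswap : ∀ i j, r i j j i = r j i i j := fun i j => by rw [hleft, hright, neg_neg]
  have h0 : e 2 * r 0 1 1 0 + e 1 * r 0 2 2 0 = 0 := by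
    refine mul_left_cancel₀ (he 0) ?_
    linear_combination hsum 0 0 - hdiag_left 0 0 0 * (e 1 * e 2)
      + hswap 0 1 * (e 0 * e 2) + hswap 0 2 * (e 0 * e 1)
  have h1 : e 2 * r 0 1 1 0 + e 0 * r 1 2 2 1 = 0 := by
    refine mul_left_cancel₀ (he 1) ?_
    linear_combination hsum 1 1 - hdiag_left 1 1 1 * (e 0 * e 2) + hswap 1 2 * (e 0 * e 1)
  have h2 : e 1 * r 0 2 2 0 + e 0 * r 1 2 2 1 = 0 := by
    refine mul_left_cancel₀ (he 2) ?_
    linear_combination hsum 2 2 - hdiag_left 2 2 2 * (e 0 * e 1)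
  have k01 : r 0 1 1 0 = 0 :=
    mul_left_cancel₀ (he 2) (by linear_combination (h0 + h1 - h2) / 2)
  have k02 : r 0 2 2 0 = 0 :=
    mul_left_cancel₀ (he 1) (by linear_combination (h0 + h2 - h1) / 2)
  have k12 : r 1 2 2 1 = 0 :=
    mul_left_cancel₀ (he 0) (by linear_combination (h1 + h2 - h0) / 2)
  have hsec : ∀ i j, r i j j i = 0 := by
    intro i j
    fin_cases i <;> fin_cases j <;>
      simp [hdiag_left, k01, k02, k12, hswap 1 0, hswap 2 0, hswap 2 1]
  have hshared : ∀ i j k, r i j k i = 0 := fun i j k => by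
    by_cases hij : i = j
    · rw [hij, hdiag_left]
    by_cases hik : i = k
    · rw [hik, hdiag_right]
    by_cases hjk : j = k
    · rw [hjk, hsec]
    exact hoff i j k hij hik hjk
  by_cases hij : i = j
  · rw [hij, hdiag_left]
  by_cases hkl : k = l
  · rw [hkl, hdiag_right]
  obtain rfl | rfl | rfl | rfl : i = l ∨ i = k ∨ j = l ∨ j = k := by omega
  · exact hshared _ _ _
  · rw [hright, hshared, neg_zero]
  · rw [hleft, hshared, neg_zero]
  · rw [hleft, hright, hshared, neg_zero, neg_zero]


/-- On a 3-dimensional real vector space with a nondegenerate symmetric bilinear form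
`g`, a formal curvature tensor with values in `𝔰𝔬(V,g)` and vanishing Ricci tensor
vanishes identically. -/
theorem ricci_flat_three_dim_flat {V : Type*} [AddCommGroup V] [Module ℝ V]
    [FiniteDimensional ℝ V] (hdim : Module.finrank ℝ V = 3)
    (g : V →ₗ[ℝ] V →ₗ[ℝ] ℝ)
    (hgsymm : ∀ x y : V, g x y = g y x)
    (hgnondeg : ∀ x : V, (∀ y : V, g x y = 0) → x = 0)
    (R : V →ₗ[ℝ] V →ₗ[ℝ] Module.End ℝ V)
    (halt : ∀ x y : V, R x y = - R y x)
    (hbianchi : ∀ x y z : V, R x y z + R y z x + R z x y = 0)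
    (hso : ∀ x y z w : V, g (R x y z) w + g z (R x y w) = 0)
    (hric : ∀ x y : V, formalRicci R x y = 0) :
    R = 0 := by
  obtain ⟨v, hv⟩ := LinearMap.BilinForm.exists_orthogonal_basis (B := g) ⟨hgsymm⟩
  let b := v.reindex (finCongr hdim)
  have hortho : ∀ i j, i ≠ j → g (b i) (b j) = 0 := fun i j hij => by
    simpa [b] using hv (i := (finCongr hdim).symm i) (j := (finCongr hdim).symm j)
      (by simpa using hij)
  have hne := self_ne_zero_of_orthogonal g hgnondeg b hortho
  have hcomp := components_eq_zero_of_contraction_eq_zero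
    (fun i j k l => g (R (b i) (b j) (b k)) (b l)) (fun i => g (b i) (b i)) hne
    (fun i j k l => by simp [halt (b i) (b j)])
    (fun i j k l => by
      rw [hgsymm (R (b i) (b j) (b l))]
      exact eq_neg_of_add_eq_zero_left (hso _ _ _ _))
    (fun j k => by
      have h := hric (b j) (b k)
      rwa [formalRicci, trace_eq_sum_div_of_orthogonal g b hortho hne] at h)
  refine b.ext fun i => b.ext fun j => b.ext fun k => hgnondeg _ fun y => ?_
  have hzero : g (R (b i) (b j) (b k)) = 0 := b.ext fun l => by simpa using hcomp i j k l
  simp [hzero]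
end

section
/- Let W be a finite-dimensional real vector space and E = W ⊗ W. Let φ ∈ E* be antisymmetric, i.e. φ(u⊗v) = −φ(v⊗u) for all u, v ∈ W, and let w ∈ E lie in the span of the elements u⊗v − v⊗u (the antisymmetric part of E). Then there exists a single endomorphism A ∈ End(W) such that the endomorphism x ↦ μ(φ)(x, w) of E equals A ⊗ Id_W + Id_W ⊗ A. -/
open scoped TensorProduct

/-- For `E = W ⊗ W`, an antisymmetric functional `φ ∈ E*` and `w` in the span of the
antisymmetric tensors `u⊗v − v⊗u`, the endomorphism `x ↦ μ(φ)(x, w)` of `E` has the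
diagonal form `A ⊗ Id_W + Id_W ⊗ A` for a single endomorphism `A ∈ End(W)`. -/
theorem mu_eval_antisym_diagonal {W : Type*}
    [AddCommGroup W] [Module ℝ W] [FiniteDimensional ℝ W]
    (hm : 1 ≤ Module.finrank ℝ W)
    (φ : W ⊗[ℝ] W →ₗ[ℝ] ℝ)
    (hφ : ∀ u v : W, φ (u ⊗ₜ[ℝ] v) = - φ (v ⊗ₜ[ℝ] u))
    (μφ : W ⊗[ℝ] W →ₗ[ℝ] W ⊗[ℝ] W →ₗ[ℝ] W ⊗[ℝ] W)
    (hμ : ∀ u v u' v' : W,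
      μφ (u ⊗ₜ[ℝ] v) (u' ⊗ₜ[ℝ] v') =
        φ (u ⊗ₜ[ℝ] v') • (u' ⊗ₜ[ℝ] v) + φ (u' ⊗ₜ[ℝ] v) • (u ⊗ₜ[ℝ] v'))
    (w : W ⊗[ℝ] W)
    (hw : w ∈ Submodule.span ℝ {x : W ⊗[ℝ] W | ∃ u v : W, x = u ⊗ₜ[ℝ] v - v ⊗ₜ[ℝ] u}) :
    ∃ A : W →ₗ[ℝ] W,
      μφ.flip w = TensorProduct.map A LinearMap.id + TensorProduct.map LinearMap.id A := by
  induction hw using Submodule.span_induction with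
  | mem x hx =>
    obtain ⟨a, b, rfl⟩ := hx
    refine ⟨(φ ∘ₗ (TensorProduct.mk ℝ W W).flip b).smulRight a -
      (φ ∘ₗ (TensorProduct.mk ℝ W W).flip a).smulRight b, TensorProduct.ext' fun u v => ?_⟩
    simp only [LinearMap.flip_apply, map_sub, hμ, LinearMap.add_apply, TensorProduct.map_tmul,
      LinearMap.sub_apply, LinearMap.smulRight_apply, LinearMap.comp_apply,
      TensorProduct.mk_apply, LinearMap.id_apply, TensorProduct.sub_tmul, TensorProduct.tmul_sub,
      ← TensorProduct.smul_tmul', TensorProduct.tmul_smul, hφ v a, hφ v b]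
    module
  | zero => exact ⟨0, by simp⟩
  | add x y _ _ hx hy =>
    obtain ⟨A, hA⟩ := hx
    obtain ⟨B, hB⟩ := hy
    refine ⟨A + B, ?_⟩
    rw [map_add, hA, hB, TensorProduct.map_add_left, TensorProduct.map_add_right]
    abel
  | smul c x _ hx =>
    obtain ⟨A, hA⟩ := hx
    refine ⟨c • A, ?_⟩
    rw [map_smul, hA, TensorProduct.map_smul_left, TensorProduct.map_smul_right, smul_add]
end
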